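/- arXiv:2407.05071 — 4 statements merged into one kernel-verified Lean document; each statement's English description precedes it below -/
import Mathlib

section
/- m₁(𝕋_K²) converges to m₁(ℝ²) as K → ∞. -/
open MeasureTheory Filter
open scoped ENNReal

noncomputable section

/-- The Haar measure on the `K × K` torus `𝕋_K² = ℝ²/(Kℤ²)` (total mass `K²`). -/
def torusVolume (K : ℝ) : Measure (AddCircle K × AddCircle K) :=
  if hK : 0 < K then
    haveI : Fact (0 < K) := ⟨hK⟩
    (volume : Measure (AddCircle K × AddCircle K))
  else 0

/-- Normalized density of a subset of the torus `𝕋_K²`. -/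
def density (K : ℝ) (A : Set (AddCircle K × AddCircle K)) : ℝ :=
  (torusVolume K A).toReal / K ^ 2

/-- Autocorrelation function `f(x; A) = δ(A ∩ (A - x))`. -/
def autocorr (K : ℝ) (A : Set (AddCircle K × AddCircle K))
    (x : AddCircle K × AddCircle K) : ℝ :=
  density K (A ∩ (fun y => y + x) ⁻¹' A)

/-- Radialized pair correlation function `f°(r; A)`. -/
def paircorr (K : ℝ) (A : Set (AddCircle K × AddCircle K)) (r : ℝ) : ℝ :=
  (1 / (2 * Real.pi)) * ∫ θ in (0:ℝ)..(2 * Real.pi),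
    autocorr K A (((r * Real.cos θ : ℝ) : AddCircle K), ((r * Real.sin θ : ℝ) : AddCircle K))

/-- Normalized pair correlation `s(r; A) = f°(r; A) / δ(A)²`. -/
def scorr (K : ℝ) (A : Set (AddCircle K × AddCircle K)) (r : ℝ) : ℝ :=
  paircorr K A r / density K A ^ 2

/-- Euclidean distance on `ℝ²`. -/
def euDist (p q : ℝ × ℝ) : ℝ := Real.sqrt ((p.1 - q.1) ^ 2 + (p.2 - q.2) ^ 2)

/-- A planar set avoiding Euclidean distance 1. -/
def Avoids1 (A : Set (ℝ × ℝ)) : Prop := ∀ p ∈ A, ∀ q ∈ A, euDist p q ≠ 1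

/-- Upper density of a planar set. -/
def upperDensity (A : Set (ℝ × ℝ)) : ℝ :=
  limsup (fun R : ℝ => (volume (A ∩ Set.Icc (-R, -R) (R, R))).toReal / (2 * R) ^ 2) atTop

/-- `m₁(ℝ²)`: the supremum of upper densities of measurable 1-avoiding planar sets. -/
def m1Plane : ℝ :=
  sSup {d : ℝ | ∃ A : Set (ℝ × ℝ), MeasurableSet A ∧ Avoids1 A ∧ d = upperDensity A}

/-- `m₁(𝕋_K²)`: the supremum of densities of measurable 1-avoiding subsets of the torus. -/
def m1Torus (K : ℝ) : ℝ :=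
  sSup {d : ℝ | ∃ A : Set (AddCircle K × AddCircle K),
    MeasurableSet A ∧ paircorr K A 1 = 0 ∧ d = density K A}

end

/-- The point of the unit circle at angle `θ`. -/
noncomputable def unitVec (θ : ℝ) : ℝ × ℝ := (Real.cos θ, Real.sin θ)

/-- The coordinatewise quotient map from the plane to the torus. -/
def toTorus (K : ℝ) (p : ℝ × ℝ) : AddCircle K × AddCircle K := (p.1, p.2)

theorem measurable_toTorus {K : ℝ} : Measurable (toTorus K) :=
  (AddCircle.measurable_mk'.comp measurable_fst).prodMk
    (AddCircle.measurable_mk'.comp measurable_snd)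

theorem density_nonneg {K : ℝ} (A : Set (AddCircle K × AddCircle K)) : 0 ≤ density K A := by
  unfold density; positivity

section Torus

variable {K : ℝ} [hK : Fact (0 < K)]

theorem torusVolume_eq_volume : torusVolume K = volume := by
  rw [torusVolume, dif_pos hK.out]

theorem volume_torus_univ :
    (volume (Set.univ : Set (AddCircle K × AddCircle K))) = ENNReal.ofReal (K ^ 2) := by
  rw [← Set.univ_prod_univ, Measure.volume_eq_prod, Measure.prod_prod, AddCircle.measure_univ,
    ← ENNReal.ofReal_mul hK.out.le, sq]

theorem density_le_one (A : Set (AddCircle K × AddCircle K)) : density K A ≤ 1 := by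
  have hK2 : 0 < K ^ 2 := pow_pos hK.out 2
  rw [density, torusVolume_eq_volume, div_le_one hK2]
  refine ENNReal.toReal_le_of_le_ofReal hK2.le ?_
  rw [← volume_torus_univ]
  exact measure_mono (Set.subset_univ _)

theorem map_coe_restrict_Ioc (a : ℝ) (n : ℕ) :
    Measure.map ((↑) : ℝ → AddCircle K) (volume.restrict (Set.Ioc a (a + n * K))) =
      (n : ℝ≥0∞) • volume := by
  induction n with
  | zero => simp
  | succ n ih =>
    have hK0 := hK.out
    have hunion : Set.Ioc a (a + (n + 1 : ℕ) * K) =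
        Set.Ioc a (a + n * K) ∪ Set.Ioc (a + n * K) (a + n * K + K) := by
      rw [Set.Ioc_union_Ioc_eq_Ioc (by nlinarith [n.cast_nonneg (α := ℝ)]) (by linarith)]
      push_cast; ring_nf
    rw [hunion, Measure.restrict_union (Set.Ioc_disjoint_Ioc_of_le le_rfl) measurableSet_Ioc,
      Measure.map_add _ _ AddCircle.measurable_mk', ih,
      (AddCircle.measurePreserving_mk K (a + n * K)).map_eq]
    push_cast
    rw [add_smul, one_smul]

theorem volume_toTorus_preimage_inter (a b : ℝ) (n : ℕ) {S : Set (AddCircle K × AddCircle K)}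
    (hS : MeasurableSet S) :
    volume (toTorus K ⁻¹' S ∩ Set.Ioc a (a + n * K) ×ˢ Set.Ioc b (b + n * K)) =
      (n : ℝ≥0∞) ^ 2 * volume S := by
  have hmap : Measure.map (toTorus K)
      (volume.restrict (Set.Ioc a (a + n * K) ×ˢ Set.Ioc b (b + n * K))) =
      ((n : ℝ≥0∞) ^ 2) • volume := by
    rw [Measure.volume_eq_prod, ← Measure.prod_restrict]
    change Measure.map (Prod.map ((↑) : ℝ → AddCircle K) ((↑) : ℝ → AddCircle K)) _ = _
    rw [← Measure.map_prod_map _ _ AddCircle.measurable_mk' AddCircle.measurable_mk',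
      map_coe_restrict_Ioc, map_coe_restrict_Ioc, Measure.prod_smul_left, Measure.prod_smul_right,
      smul_smul, sq, ← Measure.volume_eq_prod]
  rw [← Measure.restrict_apply (measurable_toTorus hS), ← Measure.map_apply measurable_toTorus hS,
    hmap, Measure.smul_apply, smul_eq_mul]

theorem volume_toTorus_preimage_eq_zero {S : Set (AddCircle K × AddCircle K)}
    (hS : MeasurableSet S) (h0 : volume S = 0) : volume (toTorus K ⁻¹' S) = 0 := by
  have hK0 := hK.out
  refine measure_mono_null (t := ⋃ n : ℕ, toTorus K ⁻¹' S ∩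
    Set.Ioc (-(n * K)) (-(n * K) + (2 * n : ℕ) * K) ×ˢ
      Set.Ioc (-(n * K)) (-(n * K) + (2 * n : ℕ) * K)) ?_ ?_
  · rintro ⟨x, y⟩ hp
    obtain ⟨n, hn⟩ := exists_nat_gt ((|x| + |y|) / K)
    rw [div_lt_iff₀ hK0] at hn
    refine Set.mem_iUnion.2 ⟨n, hp, ?_⟩
    have := neg_abs_le x; have := le_abs_self x
    have := neg_abs_le y; have := le_abs_self y
    have := abs_nonneg x; have := abs_nonneg y
    push_cast
    refine ⟨⟨?_, ?_⟩, ⟨?_, ?_⟩⟩ <;> dsimp only <;> linarith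
  · refine measure_iUnion_null fun n => ?_
    rw [volume_toTorus_preimage_inter _ _ _ hS, h0, mul_zero]

theorem ae_volume_inter_eq_zero {A : Set (AddCircle K × AddCircle K)} (hA : MeasurableSet A)
    (h : paircorr K A 1 = 0) :
    ∀ᵐ θ ∂volume.restrict (Set.Ioc 0 (2 * Real.pi)),
      volume (toTorus K ⁻¹' A ∩ (fun p => p + unitVec θ) ⁻¹' (toTorus K ⁻¹' A)) = 0 := by
  have hpi := Real.pi_pos
  have hunit : Measurable fun θ => toTorus K (unitVec θ) :=
    measurable_toTorus.comp (Real.measurable_cos.prodMk Real.measurable_sin)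
  have hshift (x : AddCircle K × AddCircle K) : MeasurableSet (A ∩ (fun y => y + x) ⁻¹' A) :=
    hA.inter ((measurable_add_const x) hA)
  have hmeas : Measurable fun θ => autocorr K A (toTorus K (unitVec θ)) := by
    have hset : MeasurableSet {z : ℝ × (AddCircle K × AddCircle K) |
        z.2 ∈ A ∧ z.2 + toTorus K (unitVec z.1) ∈ A} :=
      (measurable_snd hA).inter
        ((measurable_snd.add (hunit.comp measurable_fst)) hA)
    have := (measurable_measure_prodMk_left (ν := (volume : Measure (AddCircle K × AddCircle K)))
      hset).ennreal_toReal.div_const (K ^ 2)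
    simp only [autocorr, density, torusVolume_eq_volume]
    exact this
  have hintegrable : IntervalIntegrable (fun θ => autocorr K A (toTorus K (unitVec θ))) volume
      0 (2 * Real.pi) := by
    rw [intervalIntegrable_iff]
    refine Measure.integrableOn_of_bounded (M := 1) (by simp [Set.uIoc]) hmeas.aestronglyMeasurable ?_
    refine Eventually.of_forall fun θ => ?_
    rw [autocorr, Real.norm_of_nonneg (density_nonneg _)]
    exact density_le_one _
  have hzero : ∫ θ in (0:ℝ)..(2 * Real.pi), autocorr K A (toTorus K (unitVec θ)) = 0 := by
    simp only [paircorr, one_mul] at h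
    exact (mul_eq_zero.1 h).resolve_left (by positivity)
  rw [intervalIntegral.integral_eq_zero_iff_of_le_of_nonneg_ae (by positivity)
    (Eventually.of_forall fun θ => by exact density_nonneg _) hintegrable] at hzero
  filter_upwards [hzero] with θ hθ
  have hvol : volume (A ∩ (fun y => y + toTorus K (unitVec θ)) ⁻¹' A) = 0 := by
    have hK2 : K ^ 2 ≠ 0 := (pow_pos hK.out 2).ne'
    simp only [autocorr, density, torusVolume_eq_volume, Pi.zero_apply, div_eq_zero_iff, hK2,
      or_false] at hθ
    exact (ENNReal.toReal_eq_zero_iff _).1 hθ |>.resolve_right (measure_ne_top _ _)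
  exact volume_toTorus_preimage_eq_zero (hshift _) hvol

end Torus

theorem volume_closedBall_plane (p : ℝ × ℝ) {r : ℝ} (hr : 0 ≤ r) :
    volume (Metric.closedBall p r) = ENNReal.ofReal (4 * r ^ 2) := by
  rw [← closedBall_prod_same, Measure.volume_eq_prod, Measure.prod_prod, Real.volume_closedBall,
    Real.volume_closedBall, ← ENNReal.ofReal_mul (by positivity)]
  ring_nf

theorem eventually_lt_volume_inter_closedBall {A : Set (ℝ × ℝ)} {p : ℝ × ℝ}
    (h : Tendsto (fun r => volume (A ∩ Metric.closedBall p r) / volume (Metric.closedBall p r))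
      (nhdsWithin 0 (Set.Ioi 0)) (nhds 1)) :
    ∀ᶠ r in nhdsWithin (0 : ℝ) (Set.Ioi 0),
      ENNReal.ofReal (3 * r ^ 2) < volume (A ∩ Metric.closedBall p r) := by
  have h34 : ENNReal.ofReal (3 / 4) < 1 := by
    rw [← ENNReal.ofReal_one]; exact (ENNReal.ofReal_lt_ofReal_iff one_pos).2 (by norm_num)
  filter_upwards [h.eventually_const_lt h34, self_mem_nhdsWithin] with r hr hr0
  have hr0 : 0 < r := hr0
  rw [volume_closedBall_plane p hr0.le] at hr
  have := ENNReal.mul_lt_of_lt_div hr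
  rwa [← ENNReal.ofReal_mul (by norm_num), ← mul_assoc,
    show (3 / 4 * 4 : ℝ) = 3 by norm_num] at this

/-- Two density points of `A` at distance `u` force `A` to meet its translates by all vectors
close to `u` in positive measure. -/
theorem exists_pos_forall_volume_inter_ne_zero {A : Set (ℝ × ℝ)} (hA : MeasurableSet A)
    {p q : ℝ × ℝ}
    (hp : Tendsto (fun r => volume (A ∩ Metric.closedBall p r) / volume (Metric.closedBall p r))
      (nhdsWithin 0 (Set.Ioi 0)) (nhds 1))
    (hq : Tendsto (fun r => volume (A ∩ Metric.closedBall q r) / volume (Metric.closedBall q r))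
      (nhdsWithin 0 (Set.Ioi 0)) (nhds 1)) :
    ∃ ε > 0, ∀ u, dist (p + u) q ≤ ε → volume (A ∩ (fun x => x + u) ⁻¹' A) ≠ 0 := by
  have hscale : Tendsto (fun r : ℝ => 3 / 4 * r) (nhdsWithin 0 (Set.Ioi 0))
      (nhdsWithin 0 (Set.Ioi 0)) := by
    refine tendsto_nhdsWithin_iff.2 ⟨?_, ?_⟩
    · refine (Continuous.tendsto' (by fun_prop) 0 0 (by simp)).mono_left nhdsWithin_le_nhds
    · filter_upwards [self_mem_nhdsWithin] with r hr
      have hr : 0 < r := hr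
      exact Set.mem_Ioi.2 (by positivity)
  obtain ⟨r, hr0, hrp, hrq⟩ := ((eventually_mem_nhdsWithin (a := (0:ℝ)) (s := Set.Ioi 0)).and
    ((eventually_lt_volume_inter_closedBall hp).and
      (hscale.eventually (eventually_lt_volume_inter_closedBall hq)))).exists
  have hr0 : 0 < r := hr0
  refine ⟨r / 4, by positivity, fun u hu h0 => ?_⟩
  set s := A ∩ Metric.closedBall p r
  set t := (fun x => x + u) ⁻¹' (A ∩ Metric.closedBall q (3 / 4 * r))
  have ht_meas : MeasurableSet t :=
    measurable_add_const u (hA.inter Metric.isClosed_closedBall.measurableSet)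
  have ht : volume t = volume (A ∩ Metric.closedBall q (3 / 4 * r)) :=
    measure_preimage_add_right _ _ _
  have hts : t ⊆ Metric.closedBall p r := by
    rintro x ⟨-, hx⟩
    rw [Metric.mem_closedBall] at hx ⊢
    calc dist x p = dist (x + u) (p + u) := (dist_add_right _ _ _).symm
      _ ≤ dist (x + u) q + dist (p + u) q := dist_triangle_right _ _ _
      _ ≤ r := by linarith
  have hst : volume (s ∩ t) = 0 :=
    measure_mono_null (t := A ∩ (fun x => x + u) ⁻¹' A) (fun x hx => ⟨hx.1.1, hx.2.1⟩) h0
  have hunion := measure_union_add_inter (μ := volume) s ht_meas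
  rw [hst, add_zero] at hunion
  have hle : volume (s ∪ t) ≤ ENNReal.ofReal (4 * r ^ 2) := by
    rw [← volume_closedBall_plane p hr0.le]
    exact measure_mono (Set.union_subset Set.inter_subset_right hts)
  rw [hunion, ht] at hle
  have hlt := (ENNReal.add_lt_add hrp hrq).trans_le hle
  rw [← ENNReal.ofReal_add (by positivity) (by positivity),
    ENNReal.ofReal_lt_ofReal_iff (by positivity)] at hlt
  nlinarith

theorem exists_unitVec_eq {p q : ℝ × ℝ} (h : euDist p q = 1) :
    ∃ θ ∈ Set.Ioc 0 (2 * Real.pi), p + unitVec θ = q := by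
  have hsq : (q.1 - p.1) ^ 2 + (q.2 - p.2) ^ 2 = 1 := by
    rw [euDist, Real.sqrt_eq_one] at h
    linarith
  set z : ℂ := ⟨q.1 - p.1, q.2 - p.2⟩ with hz
  have hnorm : ‖z‖ = 1 := by
    rw [Complex.norm_def, Complex.normSq_mk, Real.sqrt_eq_one]
    linarith
  have hz0 : z ≠ 0 := by
    rw [← norm_ne_zero_iff, hnorm]; norm_num
  have hcos : Real.cos z.arg = q.1 - p.1 := by rw [Complex.cos_arg hz0, hnorm, div_one]
  have hsin : Real.sin z.arg = q.2 - p.2 := by rw [Complex.sin_arg, hnorm, div_one]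
  refine ⟨toIocMod Real.two_pi_pos 0 z.arg, ?_, ?_⟩
  · simpa using toIocMod_mem_Ioc Real.two_pi_pos 0 z.arg
  · rw [unitVec, toIocMod, zsmul_eq_mul, Real.cos_sub_int_mul_two_pi, Real.sin_sub_int_mul_two_pi,
      hcos, hsin]
    ext <;> simp

theorem dist_unitVec_le (θ φ : ℝ) : dist (unitVec θ) (unitVec φ) ≤ |θ - φ| := by
  rw [Prod.dist_eq, max_le_iff]
  exact ⟨Real.abs_cos_sub_cos_le θ φ, Real.abs_sin_sub_sin_le θ φ⟩

/-- A measurable planar set that meets almost all of its unit translates in a null set agrees up to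
a null set with a set avoiding distance `1`. -/
theorem exists_avoids1_ae_eq {A : Set (ℝ × ℝ)} (hA : MeasurableSet A)
    (h : ∀ᵐ θ ∂volume.restrict (Set.Ioc 0 (2 * Real.pi)),
      volume (A ∩ (fun p => p + unitVec θ) ⁻¹' A) = 0) :
    ∃ B : Set (ℝ × ℝ), MeasurableSet B ∧ Avoids1 B ∧ B =ᵐ[volume] A := by
  have hdens := (ae_restrict_iff' hA).1 (Besicovitch.ae_tendsto_measure_inter_div volume A)
  set N := toMeasurable volume {x | ¬ (x ∈ A → Tendsto (fun r => volume (A ∩ Metric.closedBall x r) /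
    volume (Metric.closedBall x r)) (nhdsWithin 0 (Set.Ioi 0)) (nhds 1))} with hN
  have hN0 : volume N = 0 := by rw [hN, measure_toMeasurable]; exact hdens
  have hpoint {x : ℝ × ℝ} (hx : x ∈ A \ N) := by_contra fun hc =>
    hx.2 (subset_toMeasurable volume _ fun hi => hc (hi hx.1))
  refine ⟨A \ N, hA.diff (measurableSet_toMeasurable _ _), fun p hp q hq hpq => ?_,
    sdiff_null_ae_eq_self hN0⟩
  obtain ⟨ε, hε, hne⟩ := exists_pos_forall_volume_inter_ne_zero hA (hpoint hp) (hpoint hq)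
  obtain ⟨θ, hθ, hθq⟩ := exists_unitVec_eq hpq
  have hsub : Set.Ioc (max 0 (θ - ε)) θ ⊆ Set.Ioc 0 (2 * Real.pi) := fun φ hφ =>
    ⟨(le_max_left _ _).trans_lt hφ.1, hφ.2.trans hθ.2⟩
  have hlt : max 0 (θ - ε) < θ := max_lt hθ.1 (by linarith)
  have : NeBot (ae (volume.restrict (Set.Ioc (max 0 (θ - ε)) θ))) := by
    rw [ae_neBot, Ne, Measure.restrict_eq_zero, Real.volume_Ioc, ENNReal.ofReal_eq_zero]
    linarith
  obtain ⟨φ, hφ, hφmem⟩ := ((ae_restrict_of_ae_restrict_of_subset hsub h).and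
    (ae_restrict_mem measurableSet_Ioc)).exists
  refine hne _ ?_ hφ
  rw [← hθq, dist_add_left]
  refine (dist_unitVec_le _ _).trans (abs_le.2 ⟨?_, ?_⟩)
  · linarith [(le_max_right 0 (θ - ε)).trans_lt hφmem.1]
  · linarith [hφmem.2]

theorem volume_Icc_plane {R : ℝ} (hR : 0 ≤ R) :
    volume (Set.Icc ((-R, -R) : ℝ × ℝ) (R, R)) = ENNReal.ofReal ((2 * R) ^ 2) := by
  rw [← Set.Icc_prod_Icc, Measure.volume_eq_prod, Measure.prod_prod, Real.volume_Icc,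
    ← ENNReal.ofReal_mul (by linarith)]
  ring_nf

theorem volume_inter_Icc_plane_ne_top (A : Set (ℝ × ℝ)) (R : ℝ) :
    volume (A ∩ Set.Icc ((-R, -R) : ℝ × ℝ) (R, R)) ≠ ∞ :=
  measure_ne_top_of_subset Set.inter_subset_right isCompact_Icc.measure_ne_top

theorem boxDensity_le_one (A : Set (ℝ × ℝ)) {R : ℝ} (hR : 0 < R) :
    (volume (A ∩ Set.Icc (-R, -R) (R, R))).toReal / (2 * R) ^ 2 ≤ 1 := by
  rw [div_le_one (by positivity)]
  refine ENNReal.toReal_le_of_le_ofReal (by positivity) ?_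
  rw [← volume_Icc_plane hR.le]
  exact measure_mono Set.inter_subset_right

theorem boxDensity_isBoundedUnder (A : Set (ℝ × ℝ)) :
    atTop.IsBoundedUnder (· ≤ ·)
      fun R : ℝ => (volume (A ∩ Set.Icc (-R, -R) (R, R))).toReal / (2 * R) ^ 2 :=
  isBoundedUnder_of_eventually_le
    ((eventually_gt_atTop 0).mono fun _ hR => boxDensity_le_one A hR)

theorem boxDensity_isCoboundedUnder (A : Set (ℝ × ℝ)) :
    atTop.IsCoboundedUnder (· ≤ ·)
      fun R : ℝ => (volume (A ∩ Set.Icc (-R, -R) (R, R))).toReal / (2 * R) ^ 2 :=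
  (isBoundedUnder_of_eventually_ge (a := 0)
    (Eventually.of_forall fun _ => by positivity)).isCoboundedUnder_le

theorem upperDensity_le_one (A : Set (ℝ × ℝ)) : upperDensity A ≤ 1 :=
  limsup_le_of_le (boxDensity_isCoboundedUnder A)
    ((eventually_gt_atTop 0).mono fun _ hR => boxDensity_le_one A hR)

theorem upperDensity_congr_ae {A B : Set (ℝ × ℝ)} (h : A =ᵐ[volume] B) :
    upperDensity A = upperDensity B := by
  have hvol (s : Set (ℝ × ℝ)) : volume (A ∩ s) = volume (B ∩ s) :=
    measure_congr (h.inter (ae_eq_refl s))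
  simp only [upperDensity, hvol]

theorem density_le_upperDensity_preimage {K : ℝ} [hK : Fact (0 < K)]
    {A : Set (AddCircle K × AddCircle K)} (hA : MeasurableSet A) :
    density K A ≤ upperDensity (toTorus K ⁻¹' A) := by
  have hK0 := hK.out
  have htend : Tendsto (fun n : ℕ => (n : ℝ) * K) atTop atTop :=
    tendsto_natCast_atTop_atTop.atTop_mul_const hK0
  refine le_limsup_of_frequently_le (htend.frequently (Eventually.frequently ?_))
    (boxDensity_isBoundedUnder _)
  filter_upwards [eventually_gt_atTop 0] with n hn
  have hn0 : (0 : ℝ) < n := Nat.cast_pos.2 hn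
  have hsub : toTorus K ⁻¹' A ∩ Set.Ioc (-(n * K)) (-(n * K) + (2 * n : ℕ) * K) ×ˢ
      Set.Ioc (-(n * K)) (-(n * K) + (2 * n : ℕ) * K) ⊆
      toTorus K ⁻¹' A ∩ Set.Icc (-(n * K), -(n * K)) (n * K, n * K) := by
    rw [← Set.Icc_prod_Icc]
    have hend : -(n * K) + (2 * n : ℕ) * K = n * K := by push_cast; ring
    rw [hend]
    exact Set.inter_subset_inter_right _
      (Set.prod_mono Set.Ioc_subset_Icc_self Set.Ioc_subset_Icc_self)
  have hle := ENNReal.toReal_mono (volume_inter_Icc_plane_ne_top _ _) (measure_mono hsub)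
  rw [volume_toTorus_preimage_inter _ _ _ hA, ENNReal.toReal_mul, ENNReal.toReal_pow,
    ENNReal.toReal_natCast] at hle
  rw [density, torusVolume_eq_volume, div_le_div_iff₀ (by positivity) (by positivity)]
  push_cast at hle
  nlinarith [mul_le_mul_of_nonneg_right hle (sq_nonneg K)]

theorem Icc_subset_iUnion_Ioc {R L : ℝ} (hL : 0 < L) :
    Set.Icc (-R) R ⊆ ⋃ i ∈ Finset.range (⌈2 * R / L⌉₊ + 1),
      Set.Ioc (-R - L + i * L) (-R - L + i * L + L) := by
  intro x hx
  have hnonneg : 0 ≤ (x + R) / L := div_nonneg (by linarith [hx.1]) hL.le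
  have hle := Nat.le_ceil ((x + R) / L)
  have hlt := Nat.ceil_lt_add_one hnonneg
  rw [div_le_iff₀ hL] at hle
  rw [← sub_lt_iff_lt_add, lt_div_iff₀ hL] at hlt
  refine Set.mem_iUnion₂.2 ⟨⌈(x + R) / L⌉₊, ?_, ?_, ?_⟩
  · rw [Finset.mem_range, Nat.lt_succ_iff]
    exact Nat.ceil_mono (by gcongr; linarith [hx.2])
  · linarith
  · linarith

/-- If every half-open box of side `L` contains at most measure `c` of `A`, then the upper density
of `A` is at most `c / L ^ 2`. -/
theorem upperDensity_le_of_forall_box {A : Set (ℝ × ℝ)} {L c : ℝ} (hL : 0 < L) (hc : 0 ≤ c)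
    (h : ∀ a b, volume (A ∩ Set.Ioc a (a + L) ×ˢ Set.Ioc b (b + L)) ≤ ENNReal.ofReal c) :
    upperDensity A ≤ c / L ^ 2 := by
  have hbound : ∀ R : ℝ, 0 < R →
      (volume (A ∩ Set.Icc (-R, -R) (R, R))).toReal / (2 * R) ^ 2 ≤ (1 / L + R⁻¹) ^ 2 * c := by
    intro R hR
    set n := ⌈2 * R / L⌉₊ + 1 with hn
    have hcover : A ∩ Set.Icc (-R, -R) (R, R) ⊆
        ⋃ k ∈ Finset.range n ×ˢ Finset.range n,
          A ∩ Set.Ioc (-R - L + k.1 * L) (-R - L + k.1 * L + L) ×ˢ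
            Set.Ioc (-R - L + k.2 * L) (-R - L + k.2 * L + L) := by
      rw [← Set.Icc_prod_Icc]
      rintro ⟨x, y⟩ ⟨hA, hx, hy⟩
      obtain ⟨i, hi, hxi⟩ := Set.mem_iUnion₂.1 (Icc_subset_iUnion_Ioc hL hx)
      obtain ⟨j, hj, hyj⟩ := Set.mem_iUnion₂.1 (Icc_subset_iUnion_Ioc hL hy)
      exact Set.mem_iUnion₂.2 ⟨(i, j), Finset.mem_product.2 ⟨hi, hj⟩, hA, hxi, hyj⟩
    have hvol : volume (A ∩ Set.Icc (-R, -R) (R, R)) ≤ ENNReal.ofReal ((n : ℝ) ^ 2 * c) := by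
      refine (measure_mono hcover).trans ((measure_biUnion_finset_le _ _).trans
        ((Finset.sum_le_sum fun k _ => h _ _).trans_eq ?_))
      rw [Finset.sum_const, Finset.card_product, Finset.card_range, nsmul_eq_mul,
        ENNReal.ofReal_mul (by positivity), ← Nat.cast_pow, ENNReal.ofReal_natCast, sq]
    have hn_le : (n : ℝ) ≤ 2 * R / L + 2 := by
      rw [hn]; push_cast
      linarith [Nat.ceil_lt_add_one (show 0 ≤ 2 * R / L by positivity)]
    have hreal := ENNReal.toReal_le_of_le_ofReal (by positivity) hvol
    rw [div_le_iff₀ (by positivity)]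
    calc _ ≤ (n : ℝ) ^ 2 * c := hreal
      _ ≤ (2 * R / L + 2) ^ 2 * c := by gcongr
      _ = (1 / L + R⁻¹) ^ 2 * c * (2 * R) ^ 2 := by field_simp
  have hlim : Tendsto (fun R : ℝ => (1 / L + R⁻¹) ^ 2 * c) atTop (nhds (c / L ^ 2)) := by
    have := ((tendsto_inv_atTop_zero (𝕜 := ℝ)).const_add (1 / L)).pow 2 |>.mul_const c
    convert this using 2
    field_simp; ring
  rw [← hlim.limsup_eq]
  exact limsup_le_limsup ((eventually_gt_atTop 0).mono hbound) (boxDensity_isCoboundedUnder A)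
    hlim.isBoundedUnder_le

theorem eq_add_of_coe_eq {K a x y v : ℝ} (hx : x ∈ Set.Ioc a (a + (K - 1)))
    (hy : y ∈ Set.Ioc a (a + (K - 1))) (hv : |v| ≤ 1)
    (h : (y : AddCircle K) = (x : AddCircle K) + (v : AddCircle K)) : y = x + v := by
  rw [← AddCircle.coe_add, ← sub_eq_zero, ← AddCircle.coe_sub, AddCircle.coe_eq_zero_iff] at h
  obtain ⟨n, hn⟩ := h
  rw [zsmul_eq_mul] at hn
  have hv' := abs_le.1 hv
  have hK : 0 < K := by linarith [hx.1, hx.2]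
  have hn1 : (n : ℝ) < 1 := lt_of_mul_lt_mul_right (a := K) (by linarith [hx.1, hy.2]) hK.le
  have hn2 : (-1 : ℝ) < n := lt_of_mul_lt_mul_right (a := K) (by linarith [hx.2, hy.1]) hK.le
  have hn0 : n = 0 := by
    have h1 : n < 1 := by exact_mod_cast hn1
    have h2 : -1 < n := by exact_mod_cast hn2
    omega
  rw [hn0, Int.cast_zero, zero_mul] at hn
  linarith

/-- The part of a planar `1`-avoiding set inside a box of side `K - 1` embeds into the torus of side
`K` as a `1`-avoiding set. -/
theorem exists_torus_set {K : ℝ} [hK : Fact (0 < K)] {A : Set (ℝ × ℝ)}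
    (hA : MeasurableSet A) (hA1 : Avoids1 A) (a b : ℝ) :
    ∃ B : Set (AddCircle K × AddCircle K), MeasurableSet B ∧ paircorr K B 1 = 0 ∧
      volume B = volume (A ∩ Set.Ioc a (a + (K - 1)) ×ˢ Set.Ioc b (b + (K - 1))) := by
  set Q := Set.Ioc a (a + (K - 1)) ×ˢ Set.Ioc b (b + (K - 1))
  set g : AddCircle K × AddCircle K → ℝ × ℝ := fun x =>
    (AddCircle.measurableEquivIoc K a x.1, AddCircle.measurableEquivIoc K b x.2)
  have hg : Measurable g := by fun_prop
  have hQ : MeasurableSet Q := measurableSet_Ioc.prod measurableSet_Ioc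
  have hleft (x : AddCircle K × AddCircle K) : toTorus K (g x) = x :=
    Prod.ext ((AddCircle.equivIoc K a).symm_apply_apply x.1)
      ((AddCircle.equivIoc K b).symm_apply_apply x.2)
  have hright {p : ℝ × ℝ} (hp : p ∈ Set.Ioc a (a + K) ×ˢ Set.Ioc b (b + K)) :
      g (toTorus K p) = p :=
    Prod.ext (congrArg Subtype.val ((AddCircle.equivIoc K a).apply_symm_apply ⟨p.1, hp.1⟩))
      (congrArg Subtype.val ((AddCircle.equivIoc K b).apply_symm_apply ⟨p.2, hp.2⟩))
  have hB : MeasurableSet (g ⁻¹' (A ∩ Q)) := hg (hA.inter hQ)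
  refine ⟨g ⁻¹' (A ∩ Q), hB, ?_, ?_⟩
  · have hzero (θ : ℝ) : autocorr K (g ⁻¹' (A ∩ Q)) (toTorus K (unitVec θ)) = 0 := by
      have hempty : g ⁻¹' (A ∩ Q) ∩ (fun y => y + toTorus K (unitVec θ)) ⁻¹' (g ⁻¹' (A ∩ Q)) =
          ∅ := by
        refine Set.eq_empty_of_forall_notMem fun y ⟨hy, hy'⟩ => ?_
        set p := g y with hp
        set q := g (y + toTorus K (unitVec θ)) with hq
        have hpq : toTorus K q = toTorus K p + toTorus K (unitVec θ) := by rw [hp, hq, hleft, hleft]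
        have h1 := eq_add_of_coe_eq hy.2.1 hy'.2.1 (Real.abs_cos_le_one θ) (congrArg Prod.fst hpq)
        have h2 := eq_add_of_coe_eq hy.2.2 hy'.2.2 (Real.abs_sin_le_one θ) (congrArg Prod.snd hpq)
        refine hA1 p hy.1 q hy'.1 ?_
        change q.1 = p.1 + Real.cos θ at h1
        change q.2 = p.2 + Real.sin θ at h2
        rw [euDist, Real.sqrt_eq_one, h1, h2]
        linarith [Real.cos_sq_add_sin_sq θ]
      rw [autocorr, hempty, density, measure_empty, ENNReal.toReal_zero, zero_div]
    simp only [paircorr, one_mul]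
    simp only [toTorus, unitVec] at hzero
    simp only [hzero, intervalIntegral.integral_zero, mul_zero]
  · have hvol := volume_toTorus_preimage_inter a b 1 hB
    simp only [Nat.cast_one, one_pow, one_mul] at hvol
    rw [← hvol]
    congr 1
    ext p
    constructor
    · rintro ⟨hp, hpbox⟩
      rwa [Set.mem_preimage, Set.mem_preimage, hright hpbox] at hp
    · rintro hp
      have hpbox : p ∈ Set.Ioc a (a + K) ×ˢ Set.Ioc b (b + K) :=
        Set.prod_mono (Set.Ioc_subset_Ioc_right (by linarith))
          (Set.Ioc_subset_Ioc_right (by linarith)) hp.2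
      refine ⟨?_, hpbox⟩
      rwa [Set.mem_preimage, Set.mem_preimage, hright hpbox]

theorem paircorr_empty (K r : ℝ) : paircorr K ∅ r = 0 := by
  simp [paircorr, autocorr, density]

theorem density_le_m1Torus {K : ℝ} [Fact (0 < K)] {A : Set (AddCircle K × AddCircle K)}
    (hA : MeasurableSet A) (h : paircorr K A 1 = 0) : density K A ≤ m1Torus K := by
  refine le_csSup ⟨1, ?_⟩ ⟨A, hA, h, rfl⟩
  rintro _ ⟨B, -, -, rfl⟩
  exact density_le_one B

theorem upperDensity_le_m1Plane {A : Set (ℝ × ℝ)} (hA : MeasurableSet A) (h : Avoids1 A) :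
    upperDensity A ≤ m1Plane := by
  refine le_csSup ⟨1, ?_⟩ ⟨A, hA, h, rfl⟩
  rintro _ ⟨B, -, -, rfl⟩
  exact upperDensity_le_one B

theorem m1Torus_nonneg {K : ℝ} [Fact (0 < K)] : 0 ≤ m1Torus K :=
  (density_nonneg ∅).trans (density_le_m1Torus MeasurableSet.empty (paircorr_empty K 1))

theorem m1Torus_le_m1Plane {K : ℝ} [Fact (0 < K)] : m1Torus K ≤ m1Plane := by
  refine csSup_le ⟨_, ∅, MeasurableSet.empty, paircorr_empty K 1, rfl⟩ ?_
  rintro _ ⟨A, hA, hcorr, rfl⟩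
  obtain ⟨B, hB, hB1, hBA⟩ :=
    exists_avoids1_ae_eq (measurable_toTorus hA) (ae_volume_inter_eq_zero hA hcorr)
  calc density K A ≤ upperDensity (toTorus K ⁻¹' A) := density_le_upperDensity_preimage hA
    _ = upperDensity B := (upperDensity_congr_ae hBA).symm
    _ ≤ m1Plane := upperDensity_le_m1Plane hB hB1

theorem m1Plane_le_m1Torus {K : ℝ} [hK : Fact (0 < K)] (hK1 : 1 < K) :
    m1Plane ≤ m1Torus K * K ^ 2 / (K - 1) ^ 2 := by
  refine csSup_le ⟨_, ∅, MeasurableSet.empty, fun _ hp => hp.elim, rfl⟩ ?_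
  rintro _ ⟨A, hA, hA1, rfl⟩
  refine upperDensity_le_of_forall_box (by linarith)
    (mul_nonneg m1Torus_nonneg (sq_nonneg K)) fun a b => ?_
  obtain ⟨B, hB, hB1, hvol⟩ := exists_torus_set (K := K) hA hA1 a b
  have hle := density_le_m1Torus hB hB1
  rw [density, torusVolume_eq_volume, div_le_iff₀ (pow_pos hK.out 2)] at hle
  rw [← hvol]
  exact (ENNReal.le_ofReal_iff_toReal_le (measure_ne_top _ _)
    (mul_nonneg m1Torus_nonneg (sq_nonneg K))).2 hle

/-- `m₁(𝕋_K²)` converges to `m₁(ℝ²)` as `K → ∞`. -/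
theorem m1Torus_tendsto_m1Plane :
    Tendsto m1Torus atTop (nhds m1Plane) := by
  have hlim : Tendsto (fun K : ℝ => m1Plane * (1 - K⁻¹) ^ 2) atTop (nhds m1Plane) := by
    simpa using ((tendsto_inv_atTop_zero (𝕜 := ℝ)).const_sub 1).pow 2 |>.const_mul m1Plane
  refine tendsto_of_tendsto_of_tendsto_of_le_of_le' hlim tendsto_const_nhds ?_ ?_
  · filter_upwards [eventually_gt_atTop 1] with K hK
    have : Fact (0 < K) := ⟨by linarith⟩
    have hK0 : 0 < K := this.out
    have hle := m1Plane_le_m1Torus hK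
    rw [le_div_iff₀ (pow_pos (by linarith) 2)] at hle
    have heq : m1Plane * (1 - K⁻¹) ^ 2 = m1Plane * (K - 1) ^ 2 / K ^ 2 := by field_simp
    rwa [heq, div_le_iff₀ (by positivity)]
  · filter_upwards [eventually_gt_atTop 0] with K hK
    have : Fact (0 < K) := ⟨hK⟩
    exact m1Torus_le_m1Plane
end

section
/- Let G = (V, E) be a finite simple graph with |V| = n ≥ 1, positive average degree d̄ = 2|E|/n, and maximum degree Δ(G) ≤ C·d̄ for some real C ≥ 1. Then there exists a family ℱ of subsets of V such that: (1) |ℱ| ≤ Σ_{0 ≤ i ≤ n/d̄} C(n, i); (2) every independent set I of G satisfies I ⊆ F for some F ∈ ℱ; (3) every F ∈ ℱ satisfies |F| ≤ n·(1 + 1/d̄ − 1/(4C)). -/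
open Finset

/-- The Pascal rule for partial row sums of binomial coefficients. -/
lemma sum_range_choose_succ (a k : ℕ) :
    ∑ i ∈ range (k + 2), (a + 1).choose i =
      ∑ i ∈ range (k + 2), a.choose i + ∑ i ∈ range (k + 1), a.choose i := by
  rw [sum_range_succ' _ (k + 1), sum_range_succ' (fun i => a.choose i) (k + 1)]
  simp only [Nat.choose_succ_succ, sum_add_distrib, Nat.choose_zero_right]
  ring

open Classical in
/-- If every set of more than `m` vertices spans a vertex of degree at least `D`, then the
independent subsets of a set `A` with `|A| ≤ m + k (D + 1)` are covered by few sets of size at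
most `m + k`. -/
lemma exists_containers_of_exists_large_degree {V : Type*} (G : SimpleGraph V) (m D : ℝ)
    (h : ∀ A : Finset V, m < #A → ∃ v ∈ A, D ≤ #{w ∈ A | G.Adj v w}) :
    ∀ (A : Finset V) (k : ℕ), (#A : ℝ) ≤ m + k * (D + 1) →
      ∃ 𝓕 : Finset (Finset V), #𝓕 ≤ ∑ i ∈ range (k + 1), (#A).choose i ∧
        (∀ I ⊆ A, (∀ a ∈ I, ∀ b ∈ I, ¬ G.Adj a b) → ∃ F ∈ 𝓕, I ⊆ F) ∧
        ∀ F ∈ 𝓕, (#F : ℝ) ≤ m + k := by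
  intro A
  induction A using Finset.strongInduction with
  | H A ih =>
    intro k hk
    by_cases hA : (#A : ℝ) ≤ m
    · refine ⟨{A}, ?_, fun I hI _ => ⟨A, mem_singleton_self A, hI⟩, ?_⟩
      · rw [card_singleton, sum_range_succ']
        simp
      · intro F hF
        rw [mem_singleton.1 hF]
        linarith [(Nat.cast_nonneg k : (0 : ℝ) ≤ k)]
    obtain ⟨v, hv, hvD⟩ := h A (not_le.1 hA)
    obtain _ | k := k
    · simp at hk
      exact absurd hk hA
    have hcard : #(A.erase v) + 1 = #A := card_erase_add_one hv
    have hcardR : (#(A.erase v) : ℝ) + 1 = #A := by exact_mod_cast hcard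
    set B := {w ∈ A.erase v | ¬ G.Adj v w}
    have hBsub : B ⊆ A.erase v := filter_subset _ _
    have hnbr : {w ∈ A.erase v | G.Adj v w} = {w ∈ A | G.Adj v w} := by
      ext w
      simp only [mem_filter, mem_erase]
      exact ⟨fun ⟨⟨_, hw⟩, hvw⟩ => ⟨hw, hvw⟩, fun ⟨hw, hvw⟩ => ⟨⟨hvw.ne', hw⟩, hvw⟩⟩
    have hBcard : (#{w ∈ A | G.Adj v w} : ℝ) + #B = #(A.erase v) := by
      rw [← hnbr]
      exact_mod_cast card_filter_add_card_filter_not (s := A.erase v) (fun w => G.Adj v w)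
    obtain ⟨𝓕₁, hcard₁, hcover₁, hsize₁⟩ :=
      ih (A.erase v) (erase_ssubset hv) (k + 1) (by linarith)
    obtain ⟨𝓕₂, hcard₂, hcover₂, hsize₂⟩ :=
      ih B (hBsub.trans_ssubset (erase_ssubset hv)) k (by push_cast at hk; linarith)
    refine ⟨𝓕₁ ∪ 𝓕₂.image (insert v), ?_, ?_, ?_⟩
    · rw [← hcard, sum_range_choose_succ]
      refine (card_union_le _ _).trans (add_le_add hcard₁ ?_)
      refine (card_image_le.trans hcard₂).trans (sum_le_sum fun i _ => ?_)
      exact Nat.choose_le_choose i (card_le_card hBsub)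
    · intro I hI hind
      by_cases hvI : v ∈ I
      · obtain ⟨F, hF, hIF⟩ := hcover₂ (I.erase v)
          (fun w hw => mem_filter.2 ⟨erase_subset_erase v hI hw,
            hind v hvI w (mem_of_mem_erase hw)⟩)
          (fun a ha b hb => hind a (mem_of_mem_erase ha) b (mem_of_mem_erase hb))
        exact ⟨insert v F, mem_union_right _ (mem_image_of_mem _ hF),
          subset_insert_iff.2 hIF⟩
      · obtain ⟨F, hF, hIF⟩ := hcover₁ I (subset_erase.2 ⟨hI, hvI⟩) hind
        exact ⟨F, mem_union_left _ hF, hIF⟩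
    · intro F hF
      rcases mem_union.1 hF with hF | hF
      · exact hsize₁ F hF
      · obtain ⟨F', hF', rfl⟩ := mem_image.1 hF
        have hins : (#(insert v F') : ℝ) ≤ #F' + 1 := by exact_mod_cast card_insert_le v F'
        have := hsize₂ F' hF'
        push_cast
        linarith

open Classical in
/-- If all degrees are at most `M`, the induced degrees on `A` sum to at least the total degree
minus `2 M` for each vertex outside `A`. -/
lemma sum_degree_sub_le_sum_induced_degree {V : Type*} [Fintype V] (G : SimpleGraph V) (M : ℝ)
    (hM : ∀ v, (G.degree v : ℝ) ≤ M) (A : Finset V) :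
    ∑ v, (G.degree v : ℝ) - 2 * (#Aᶜ * M) ≤ ∑ v ∈ A, (#{w ∈ A | G.Adj v w} : ℝ) := by
  have hsplit : ∀ v, (G.degree v : ℝ) = #{w ∈ A | G.Adj v w} + #{w ∈ Aᶜ | G.Adj v w} := by
    intro v
    rw [← G.card_neighborFinset_eq_degree, G.neighborFinset_eq_filter, ← Nat.cast_add,
      ← card_union_of_disjoint (disjoint_filter_filter disjoint_compl_right), ← filter_union,
      union_compl]
  have hswap : ∑ v ∈ A, (#{w ∈ Aᶜ | G.Adj v w} : ℝ) = ∑ v ∈ Aᶜ, (#{w ∈ A | G.Adj v w} : ℝ) := by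
    have hbelow : ∀ v, {w ∈ A | G.Adj v w} = bipartiteBelow G.Adj A v := fun v => by
      simp only [bipartiteBelow, G.adj_comm v]
    simp only [hbelow]
    exact_mod_cast sum_card_bipartiteAbove_eq_sum_card_bipartiteBelow (s := A) (t := Aᶜ) G.Adj
  have hout : ∑ v ∈ Aᶜ, (G.degree v : ℝ) ≤ #Aᶜ * M := by
    simpa using sum_le_card_nsmul Aᶜ (fun v => (G.degree v : ℝ)) M fun v _ => hM v
  have hcross : ∑ v ∈ Aᶜ, (#{w ∈ A | G.Adj v w} : ℝ) ≤ ∑ v ∈ Aᶜ, (G.degree v : ℝ) :=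
    sum_le_sum fun v _ => by rw [hsplit v]; simp
  have hin : ∑ v ∈ A, (G.degree v : ℝ) =
      ∑ v ∈ A, (#{w ∈ A | G.Adj v w} : ℝ) + ∑ v ∈ A, (#{w ∈ Aᶜ | G.Adj v w} : ℝ) := by
    rw [← sum_add_distrib]
    exact sum_congr rfl fun v _ => hsplit v
  rw [← sum_add_sum_compl A]
  linarith

/-- Weak container lemma, degree-regular form: let `G` be a finite simple graph on `n ≥ 1`
vertices with positive average degree `d̄ = 2|E|/n` and maximum degree at most `C·d̄` for some
`C ≥ 1`. Then there is a family `ℱ` of subsets of `V` with `|ℱ| ≤ Σ_{0 ≤ i ≤ n/d̄} C(n, i)`,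
such that every independent set of `G` is contained in some member of `ℱ`, and every `F ∈ ℱ`
has `|F| ≤ n·(1 + 1/d̄ − 1/(4C))`. -/
theorem weak_containers_bounded_degree {V : Type*} [Fintype V] (G : SimpleGraph V)
    (hn : 1 ≤ Fintype.card V) (C : ℝ) (hC : 1 ≤ C) (dbar : ℝ)
    (hdbar : dbar = 2 * (G.edgeSet.ncard : ℝ) / (Fintype.card V : ℝ)) (hpos : 0 < dbar)
    (hmaxdeg : ∀ v : V, ((G.neighborSet v).ncard : ℝ) ≤ C * dbar) :
    ∃ 𝓕 : Finset (Finset V),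
      (𝓕.card : ℝ) ≤
          ((∑ i ∈ Finset.range (⌊(Fintype.card V : ℝ) / dbar⌋₊ + 1),
              (Fintype.card V).choose i : ℕ) : ℝ) ∧
      (∀ I : Finset V, (∀ a ∈ I, ∀ b ∈ I, ¬ G.Adj a b) → ∃ F ∈ 𝓕, I ⊆ F) ∧
      ∀ F ∈ 𝓕, (F.card : ℝ) ≤ (Fintype.card V : ℝ) * (1 + 1 / dbar - 1 / (4 * C)) := by
  classical
  set n : ℝ := (Fintype.card V : ℝ)
  have hn0 : 0 < n := Nat.cast_pos.2 hn
  have hC0 : 0 < C := by linarith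
  have hdeg : ∀ v, (G.degree v : ℝ) ≤ C * dbar := fun v => by
    have := hmaxdeg v
    rwa [Set.ncard_eq_toFinset_card', Set.toFinset_card, G.card_neighborSet_eq_degree] at this
  have hsum : ∑ v, (G.degree v : ℝ) = n * dbar := by
    have hedges : G.edgeSet.ncard = #G.edgeFinset := by
      rw [Set.ncard_eq_toFinset_card', SimpleGraph.edgeFinset]
    rw [hdbar, hedges, mul_div_cancel₀ _ hn0.ne']
    exact_mod_cast G.sum_degrees_eq_twice_card_edges
  have hdn : dbar ≤ n := by
    have hle : ∑ v, (G.degree v : ℝ) ≤ n * n := by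
      simpa using sum_le_card_nsmul univ (fun v => (G.degree v : ℝ)) n
        fun v _ => Nat.cast_le.2 (G.degree_lt_card_verts v).le
    exact le_of_mul_le_mul_left (hsum ▸ hle) hn0
  have hquarter : n / (4 * C) ≤ n / 4 :=
    div_le_div_of_nonneg_left hn0.le (by norm_num) (by linarith)
  have hlarge : ∀ A : Finset V, n - n / (4 * C) < #A →
      ∃ v ∈ A, dbar / 2 ≤ #{w ∈ A | G.Adj v w} := by
    intro A hA
    have hApos : (0 : ℝ) < #A := by linarith
    have hAn : (#A : ℝ) ≤ n := Nat.cast_le.2 (card_le_univ A)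
    have hcompl : (#Aᶜ : ℝ) = n - #A := by
      rw [card_compl, Nat.cast_sub (card_le_univ A)]
    refine exists_le_of_sum_le (card_pos.1 (Nat.cast_pos.1 hApos)) ?_
    have hinduced := sum_degree_sub_le_sum_induced_degree G (C * dbar) hdeg A
    have hloss : (n - #A) * (C * dbar) ≤ n / (4 * C) * (C * dbar) := by
      gcongr
      linarith
    have hcancel : n / (4 * C) * (C * dbar) = n * dbar / 4 := by field_simp
    rw [hcompl, hsum] at hinduced
    rw [sum_const, nsmul_eq_mul]
    nlinarith
  set k := ⌊n / dbar⌋₊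
  have hfloor : (k : ℝ) ≤ n / dbar := Nat.floor_le (by positivity)
  have hk1 : (1 : ℝ) ≤ k := by
    exact_mod_cast Nat.le_floor (by rw [Nat.cast_one, one_le_div hpos]; exact hdn)
  have hk2 : n ≤ 2 * k * dbar := by
    rw [← div_le_iff₀ hpos]
    linarith [Nat.lt_floor_add_one (n / dbar)]
  obtain ⟨𝓕, hcard, hcover, hsize⟩ := exists_containers_of_exists_large_degree G
    (n - n / (4 * C)) (dbar / 2) hlarge univ k (by rw [card_univ]; linarith)
  refine ⟨𝓕, Nat.cast_le.2 hcard, fun I hI => hcover I (subset_univ I) hI, fun F hF => ?_⟩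
  have hexpand : n * (1 + 1 / dbar - 1 / (4 * C)) = n + n / dbar - n / (4 * C) := by ring
  linarith [hsize F hF]
end

section
/- There exists a constant C > 0 such that for all integers K ≥ 3 and N ≥ 1, every vertex of the graph 𝒢(N,K) has degree at most C·N. -/
open MeasureTheory Filter
open scoped ENNReal

noncomputable section

/-- The closed grid square `[j/N,(j+1)/N] × [k/N,(k+1)/N]`, viewed inside the torus `𝕋_K²`. -/
def gridSquare (K N : ℕ) (v : Fin (N * K) × Fin (N * K)) :
    Set (AddCircle (K : ℝ) × AddCircle (K : ℝ)) :=
  {q | ∃ p : ℝ × ℝ, q = ((p.1 : AddCircle (K : ℝ)), (p.2 : AddCircle (K : ℝ))) ∧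
        (v.1 : ℝ) / N ≤ p.1 ∧ p.1 ≤ ((v.1 : ℝ) + 1) / N ∧
        (v.2 : ℝ) / N ≤ p.2 ∧ p.2 ≤ ((v.2 : ℝ) + 1) / N}

/-- A subset of `𝕋_K²` is locally constant at scale `1/N` if it is a union of grid squares. -/
def LocallyConst (K N : ℕ) (A : Set (AddCircle (K : ℝ) × AddCircle (K : ℝ))) : Prop :=
  ∃ S : Set (Fin (N * K) × Fin (N * K)), A = ⋃ v ∈ S, gridSquare K N v

/-- Euclidean distance on the torus `𝕋_K²`. -/
def torusDist {K : ℝ} (x y : AddCircle K × AddCircle K) : ℝ :=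
  Real.sqrt (‖x.1 - y.1‖ ^ 2 + ‖x.2 - y.2‖ ^ 2)

/-- The graph `𝒢(N, K)` on grid squares: two distinct squares are adjacent iff one contains a
point `x` and the other a point `y` with `|x - y| = 1` in the torus. -/
def unitGraph (K N : ℕ) : SimpleGraph (Fin (N * K) × Fin (N * K)) :=
  SimpleGraph.fromRel fun v w =>
    ∃ x ∈ gridSquare K N v, ∃ y ∈ gridSquare K N w, torusDist x y = 1

/-- The subset `A_F ⊆ 𝕋_K²` given by the union of the squares in `F`. -/
def unionSquares (K N : ℕ) (F : Finset (Fin (N * K) × Fin (N * K))) :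
    Set (AddCircle (K : ℝ) × AddCircle (K : ℝ)) :=
  ⋃ v ∈ F, gridSquare K N v

/-- An independent set of a simple graph. -/
def IsIndep {V : Type*} (G : SimpleGraph V) (s : Finset V) : Prop :=
  ∀ a ∈ s, ∀ b ∈ s, ¬ G.Adj a b

end

/-- A point of the unit circle is within `1 / N` of the point of angle `j / N`, for some integer
`j ∈ [-4N, 4N)`. -/
theorem exists_int_angle_near {N : ℕ} (hN : 1 ≤ N) {s t : ℝ} (h : s ^ 2 + t ^ 2 = 1) :
    ∃ j ∈ Finset.Ico (-(4 * N : ℤ)) (4 * N),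
      |N * s - N * Real.cos (j / N)| ≤ 1 ∧ |N * t - N * Real.sin (j / N)| ≤ 1 := by
  have hN0 : (0 : ℝ) < N := by exact_mod_cast hN
  obtain ⟨θ, hlo, hhi, rfl, rfl⟩ :
      ∃ θ : ℝ, -Real.pi < θ ∧ θ ≤ Real.pi ∧ Real.cos θ = s ∧ Real.sin θ = t := by
    have hn : ‖(⟨s, t⟩ : ℂ)‖ = 1 := by
      rw [Complex.norm_def, Complex.normSq_mk, ← sq, ← sq, h, Real.sqrt_one]
    refine ⟨Complex.arg ⟨s, t⟩, Complex.neg_pi_lt_arg _, Complex.arg_le_pi _, ?_, ?_⟩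
    · simpa [hn] using Complex.norm_mul_cos_arg ⟨s, t⟩
    · simpa [hn] using Complex.norm_mul_sin_arg ⟨s, t⟩
  have hπ := Real.pi_lt_four
  have hfl := Int.floor_le (N * θ)
  have hfu := Int.lt_floor_add_one (N * θ)
  have hsub : (N : ℝ) * |θ - ⌊N * θ⌋ / N| ≤ 1 := by
    rw [← abs_of_pos hN0, ← abs_mul, abs_of_pos hN0, mul_sub, mul_div_cancel₀ _ hN0.ne', abs_le]
    constructor <;> linarith
  refine ⟨⌊N * θ⌋, ?_, ?_, ?_⟩
  · rw [Finset.mem_Ico, Int.le_floor, Int.floor_lt]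
    push_cast
    constructor <;> nlinarith
  · rw [← mul_sub, abs_mul, abs_of_pos hN0]
    exact (mul_le_mul_of_nonneg_left (Real.abs_cos_sub_cos_le _ _) hN0.le).trans hsub
  · rw [← mul_sub, abs_mul, abs_of_pos hN0]
    exact (mul_le_mul_of_nonneg_left (Real.abs_sin_sub_sin_le _ _) hN0.le).trans hsub

theorem torusDist_comm {K : ℝ} (x y : AddCircle K × AddCircle K) :
    torusDist x y = torusDist y x := by
  simp only [torusDist, norm_sub_rev]

/-- If the grid squares `v` and `w` contain points at distance `1`, then suitable integer lifts of
the displacement from `v` to `w` lie within `1` of a point of the circle of radius `N`. -/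
theorem exists_lift_near_circle {K N : ℕ} (hN : 1 ≤ N) {v w : Fin (N * K) × Fin (N * K)}
    (h : ∃ x ∈ gridSquare K N v, ∃ y ∈ gridSquare K N w, torusDist x y = 1) :
    ∃ (s t : ℝ) (m n : ℤ), s ^ 2 + t ^ 2 = 1 ∧
      |(((w.1 : ℤ) - v.1 + m * (N * K : ℕ) : ℤ) : ℝ) - N * s| ≤ 1 ∧
      |(((w.2 : ℤ) - v.2 + n * (N * K : ℕ) : ℤ) : ℝ) - N * t| ≤ 1 := by
  have hN0 : (0 : ℝ) < N := by exact_mod_cast hN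
  obtain ⟨_, ⟨p, rfl, hp⟩, _, ⟨q, rfl, hq⟩, hd⟩ := h
  rw [torusDist_comm, torusDist, Real.sqrt_eq_one] at hd
  simp only [← AddCircle.coe_sub, AddCircle.norm_eq, sq_abs] at hd
  refine ⟨_, _, -round ((K : ℝ)⁻¹ * (q.1 - p.1)), -round ((K : ℝ)⁻¹ * (q.2 - p.2)), hd, ?_, ?_⟩
  all_goals
    simp only [div_le_iff₀ hN0, le_div_iff₀ hN0] at hp hq
    push_cast
    rw [abs_le]
    constructor <;> linarith

/-- An integer within `1` of a real that is itself within `1` of `x` is `⌊x⌋ + a`, `|a| ≤ 2`. -/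
theorem sub_floor_mem_Icc {d : ℤ} {x y : ℝ} (hd : |(d : ℝ) - y| ≤ 1) (hy : |y - x| ≤ 1) :
    d - ⌊x⌋ ∈ Finset.Icc (-2 : ℤ) 2 := by
  rw [abs_le] at hd hy
  have hfl := Int.floor_le x
  have hfu := Int.lt_floor_add_one x
  have hlo : ((-3 : ℤ) : ℝ) < ((d - ⌊x⌋ : ℤ) : ℝ) := by push_cast; linarith
  have hhi : ((d - ⌊x⌋ : ℤ) : ℝ) < ((3 : ℤ) : ℝ) := by push_cast; linarith
  rw [Int.cast_lt] at hlo hhi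
  rw [Finset.mem_Icc]
  omega

/-- There is a constant `C > 0` such that for all integers `K ≥ 3` and `N ≥ 1`, every vertex of
the graph `𝒢(N, K)` has degree at most `C·N`. -/
theorem unitGraph_maxDegree :
    ∃ C > (0:ℝ), ∀ K N : ℕ, 3 ≤ K → 1 ≤ N →
      ∀ v : Fin (N * K) × Fin (N * K),
        (((unitGraph K N).neighborSet v).ncard : ℝ) ≤ C * N := by
  refine ⟨200, by norm_num, fun K N _ hN v => ?_⟩
  let toInt : Fin (N * K) × Fin (N * K) → ℤ × ℤ := fun w => (w.1, w.2)
  have toInt_inj : Function.Injective toInt := by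
    rintro ⟨a, b⟩ ⟨c, d⟩ h
    simp only [toInt, Prod.mk.injEq, Nat.cast_inj] at h
    exact Prod.ext (Fin.ext h.1) (Fin.ext h.2)
  let index : Finset (ℤ × ℤ × ℤ) :=
    Finset.Ico (-(4 * N : ℤ)) (4 * N) ×ˢ Finset.Icc (-2) 2 ×ˢ Finset.Icc (-2) 2
  let place : ℤ × ℤ × ℤ → ℤ × ℤ := fun i =>
    ((v.1 + (⌊N * Real.cos (i.1 / N)⌋ + i.2.1)) % (N * K : ℕ),
      (v.2 + (⌊N * Real.sin (i.1 / N)⌋ + i.2.2)) % (N * K : ℕ))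
  have hsub : toInt '' (unitGraph K N).neighborSet v ⊆ (index.image place : Finset (ℤ × ℤ)) := by
    rintro _ ⟨w, hw, rfl⟩
    rw [SimpleGraph.mem_neighborSet, unitGraph, SimpleGraph.fromRel_adj] at hw
    have hvw : ∃ x ∈ gridSquare K N v, ∃ y ∈ gridSquare K N w, torusDist x y = 1 := by
      rcases hw.2 with h | ⟨x, hx, y, hy, h⟩
      · exact h
      · exact ⟨y, hy, x, hx, torusDist_comm x y ▸ h⟩
    obtain ⟨s, t, m, n, hst, hs, ht⟩ := exists_lift_near_circle hN hvw
    obtain ⟨j, hj, hjs, hjt⟩ := exists_int_angle_near hN hst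
    have emod_lift (a b : Fin (N * K)) (m c : ℤ) :
        ((a : ℤ) + (c + ((b : ℤ) - a + m * (N * K : ℕ) - c))) % (N * K : ℕ) = b := by
      rw [show (a : ℤ) + (c + ((b : ℤ) - a + m * (N * K : ℕ) - c)) = b + m * (N * K : ℕ) by ring,
        Int.add_mul_emod_self_right]
      exact Int.emod_eq_of_lt (by positivity) (by exact_mod_cast b.2)
    rw [Finset.mem_coe, Finset.mem_image]
    refine ⟨(j, _, _), Finset.mem_product.2 ⟨hj, Finset.mem_product.2
      ⟨sub_floor_mem_Icc hs hjs, sub_floor_mem_Icc ht hjt⟩⟩, ?_⟩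
    exact Prod.ext (emod_lift _ _ _ _) (emod_lift _ _ _ _)
  have hindex : index.card = 200 * N := by
    simp only [index, Finset.card_product, Int.card_Ico, Int.card_Icc]
    rw [show (2 + 1 - -2 : ℤ).toNat = 5 from rfl]
    omega
  have hcard : ((unitGraph K N).neighborSet v).ncard ≤ 200 * N := by
    rw [← Set.ncard_image_of_injective _ toInt_inj, ← hindex]
    refine (Set.ncard_le_ncard hsub (Finset.finite_toSet _)).trans ?_
    rw [Set.ncard_coe_finset]
    exact Finset.card_image_le
  exact_mod_cast hcard
end

section
/- Let Λ = {2a·(1, 0) + 2b·(1/2, √3/2) : a, b ∈ ℤ} ⊂ ℝ² and let A = ⋃_{v ∈ Λ} B(v, 1/2) be the union of the open Euclidean balls of radius 1/2 centered at the points of Λ. Then no two points of A are at Euclidean distance exactly 1, and the density lim_{R→∞} λ₂(A ∩ [−R, R]²)/(2R)² exists and equals π/(8√3). -/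
open MeasureTheory Filter

noncomputable section

/-- The hexagonal lattice `Λ = {2a·(1, 0) + 2b·(1/2, √3/2) : a, b ∈ ℤ}`. -/
def hexLattice : Set (ℝ × ℝ) :=
  {p | ∃ a b : ℤ, p = (2 * (a : ℝ) * 1 + 2 * (b : ℝ) * (1 / 2),
    2 * (a : ℝ) * 0 + 2 * (b : ℝ) * (Real.sqrt 3 / 2))}

/-- The union of the open Euclidean balls of radius `1/2` centered at the hexagonal lattice. -/
def hexPacking : Set (ℝ × ℝ) :=
  ⋃ v ∈ hexLattice, {x : ℝ × ℝ | euDist x v < 1 / 2}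

end

theorem euDist_eq_dist (p q : ℝ × ℝ) :
    euDist p q =
      dist (Complex.measurableEquivRealProd.symm p) (Complex.measurableEquivRealProd.symm q) := by
  rw [Complex.dist_eq_re_im]
  rfl

theorem euDist_comm (p q : ℝ × ℝ) : euDist p q = euDist q p := by
  simp only [euDist_eq_dist, dist_comm]

theorem euDist_triangle (p q r : ℝ × ℝ) : euDist p r ≤ euDist p q + euDist q r := by
  simp only [euDist_eq_dist, dist_triangle]

theorem abs_fst_sub_le_euDist (p q : ℝ × ℝ) : |p.1 - q.1| ≤ euDist p q :=
  Real.abs_le_sqrt (by nlinarith [sq_nonneg (p.2 - q.2)])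

theorem abs_snd_sub_le_euDist (p q : ℝ × ℝ) : |p.2 - q.2| ≤ euDist p q :=
  Real.abs_le_sqrt (by nlinarith [sq_nonneg (p.1 - q.1)])

/-- The open Euclidean disc in `ℝ × ℝ`. -/
def euBall (v : ℝ × ℝ) (r : ℝ) : Set (ℝ × ℝ) := {x | euDist x v < r}

theorem euBall_eq_preimage (v : ℝ × ℝ) (r : ℝ) :
    euBall v r = Complex.measurableEquivRealProd.symm ⁻¹'
      Metric.ball (Complex.measurableEquivRealProd.symm v) r := by
  ext x
  simp only [euBall, euDist_eq_dist, Set.mem_ofPred_eq, Set.mem_preimage, Metric.mem_ball]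

theorem measurableSet_euBall (v : ℝ × ℝ) (r : ℝ) : MeasurableSet (euBall v r) := by
  rw [euBall_eq_preimage]
  exact Complex.measurableEquivRealProd.symm.measurable measurableSet_ball

theorem volume_euBall (v : ℝ × ℝ) (r : ℝ) :
    volume (euBall v r) = ENNReal.ofReal r ^ 2 * NNReal.pi := by
  rw [euBall_eq_preimage, (Complex.volume_preserving_equiv_real_prod.symm).measure_preimage
    measurableSet_ball.nullMeasurableSet, Complex.volume_ball]

theorem volume_euBall_half_toReal (v : ℝ × ℝ) :
    (volume (euBall v (1 / 2))).toReal = Real.pi / 4 := by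
  rw [volume_euBall, ENNReal.toReal_mul, ENNReal.toReal_pow, ENNReal.toReal_ofReal (by norm_num),
    ENNReal.coe_toReal, NNReal.coe_real_pi]
  ring

/-- The point of the hexagonal lattice with second coordinate index `p.1` and first `p.2`. -/
noncomputable def hexPoint (p : Σ _ : ℤ, ℤ) : ℝ × ℝ := (2 * p.2 + p.1, √3 * p.1)

theorem hexPacking_eq_iUnion : hexPacking = ⋃ p, euBall (hexPoint p) (1 / 2) := by
  ext x
  simp only [hexPacking, hexLattice, Set.mem_iUnion, Set.mem_ofPred_eq, euBall, exists_prop]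
  constructor
  · rintro ⟨v, ⟨a, b, rfl⟩, h⟩
    refine ⟨⟨b, a⟩, ?_⟩
    convert h using 2
    ext <;> simp only [hexPoint] <;> ring
  · rintro ⟨⟨b, a⟩, h⟩
    refine ⟨_, ⟨a, b, rfl⟩, ?_⟩
    convert h using 2
    ext <;> simp only [hexPoint] <;> ring

theorem two_le_euDist_hexPoint {p q : Σ _ : ℤ, ℤ} (h : p ≠ q) :
    2 ≤ euDist (hexPoint p) (hexPoint q) := by
  obtain ⟨b, a⟩ := p
  obtain ⟨d, c⟩ := q
  have key : (1 : ℤ) ≤ (a - c) ^ 2 + (a - c) * (b - d) + (b - d) ^ 2 := by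
    by_contra! hlt
    have hb : (b - d) ^ 2 = 0 := by
      nlinarith [sq_nonneg (2 * (a - c) + (b - d)), sq_nonneg (b - d)]
    have hb' : b - d = 0 := by simpa using hb
    have ha' : a - c = 0 := by
      rw [hb'] at hlt
      have : (a - c) ^ 2 = 0 := by nlinarith [sq_nonneg (a - c)]
      simpa using this
    obtain rfl : a = c := by omega
    obtain rfl : b = d := by omega
    exact h rfl
  have key' : (1 : ℝ) ≤ (a - c) ^ 2 + (a - c) * (b - d) + (b - d) ^ 2 := by exact_mod_cast key
  refine Real.le_sqrt_of_sq_le ?_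
  have h3 : √3 ^ 2 = 3 := Real.sq_sqrt (by norm_num)
  simp only [hexPoint]
  have : (√3 * b - √3 * d) ^ 2 = 3 * ((b : ℝ) - d) ^ 2 := by
    rw [← mul_sub, mul_pow, h3]
  rw [this]
  nlinarith

theorem euDist_ne_one_of_mem_hexPacking {x y : ℝ × ℝ} (hx : x ∈ hexPacking)
    (hy : y ∈ hexPacking) : euDist x y ≠ 1 := by
  simp only [hexPacking_eq_iUnion, Set.mem_iUnion, euBall, Set.mem_ofPred_eq] at hx hy
  obtain ⟨p, hp⟩ := hx
  obtain ⟨q, hq⟩ := hy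
  rcases eq_or_ne p q with rfl | hpq
  · have := euDist_triangle x (hexPoint p) y
    rw [euDist_comm (hexPoint p) y] at this
    linarith
  · have h₁ := two_le_euDist_hexPoint hpq
    have h₂ := euDist_triangle (hexPoint p) x (hexPoint q)
    have h₃ := euDist_triangle x y (hexPoint q)
    rw [euDist_comm _ x] at h₂
    linarith

theorem pairwise_disjoint_euBall_hexPoint :
    Pairwise (Function.onFun Disjoint fun p => euBall (hexPoint p) (1 / 2)) := by
  intro p q hpq
  refine Set.disjoint_left.2 fun x hp hq => ?_
  simp only [euBall, Set.mem_ofPred_eq] at hp hq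
  have h₁ := two_le_euDist_hexPoint hpq
  have h₂ := euDist_triangle (hexPoint p) x (hexPoint q)
  rw [euDist_comm _ x] at h₂
  linarith

theorem sub_sub_one_le_card_Icc_ceil_floor (x y : ℝ) :
    y - x - 1 ≤ ((Finset.Icc ⌈x⌉ ⌊y⌋).card : ℝ) := by
  rw [Int.card_Icc]
  have h : ((⌊y⌋ + 1 - ⌈x⌉ : ℤ) : ℝ) ≤ ((⌊y⌋ + 1 - ⌈x⌉).toNat : ℝ) := by
    exact_mod_cast Int.self_le_toNat _
  push_cast at h
  linarith [Int.lt_floor_add_one y, Int.ceil_lt_add_one x]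

theorem card_Icc_ceil_floor_le {x y : ℝ} (hxy : x ≤ y) :
    ((Finset.Icc ⌈x⌉ ⌊y⌋).card : ℝ) ≤ y - x + 1 := by
  rw [Int.card_Icc]
  have h : ((⌊y⌋ + 1 - ⌈x⌉).toNat : ℝ) = ((max (⌊y⌋ + 1 - ⌈x⌉) 0 : ℤ) : ℝ) := by
    exact_mod_cast Int.toNat_eq_max _
  rw [h]
  push_cast
  exact max_le (by linarith [Int.floor_le y, Int.le_ceil x]) (by linarith)

/-- The indices of the hexagonal lattice points lying in the square `[-r, r]²`. -/
noncomputable def hexIndices (r : ℝ) : Finset (Σ _ : ℤ, ℤ) :=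
  (Finset.Icc ⌈-r / √3⌉ ⌊r / √3⌋).sigma fun b => Finset.Icc ⌈(-r - b) / 2⌉ ⌊(r - b) / 2⌋

theorem mem_hexIndices {r : ℝ} {p : Σ _ : ℤ, ℤ} :
    p ∈ hexIndices r ↔ |(hexPoint p).1| ≤ r ∧ |(hexPoint p).2| ≤ r := by
  have h3 : 0 < √3 := by positivity
  simp only [hexIndices, Finset.mem_sigma, Finset.mem_Icc, Int.ceil_le, Int.le_floor, hexPoint,
    abs_le, div_le_iff₀ h3, le_div_iff₀ h3, div_le_iff₀ (two_pos : (0 : ℝ) < 2),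
    le_div_iff₀ (two_pos : (0 : ℝ) < 2)]
  constructor <;> rintro ⟨⟨h₁, h₂⟩, h₃, h₄⟩ <;> refine ⟨⟨?_, ?_⟩, ?_, ?_⟩ <;> linarith

theorem le_card_hexIndices {r : ℝ} (hr : 1 ≤ r) :
    (2 * r / √3 - 1) * (r - 1) ≤ ((hexIndices r).card : ℝ) := by
  rw [hexIndices, Finset.card_sigma, Nat.cast_sum]
  calc (2 * r / √3 - 1) * (r - 1)
      ≤ ((Finset.Icc ⌈-r / √3⌉ ⌊r / √3⌋).card : ℝ) * (r - 1) := by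
        refine mul_le_mul_of_nonneg_right ?_ (by linarith)
        refine le_trans (le_of_eq ?_) (sub_sub_one_le_card_Icc_ceil_floor _ _)
        ring
    _ ≤ _ := by
        rw [← nsmul_eq_mul]
        refine Finset.card_nsmul_le_sum _ _ _ fun b _ => ?_
        refine le_trans (le_of_eq ?_) (sub_sub_one_le_card_Icc_ceil_floor _ _)
        ring

theorem card_hexIndices_le {r : ℝ} (hr : 0 ≤ r) :
    ((hexIndices r).card : ℝ) ≤ (2 * r / √3 + 1) * (r + 1) := by
  rw [hexIndices, Finset.card_sigma, Nat.cast_sum]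
  calc _ ≤ ((Finset.Icc ⌈-r / √3⌉ ⌊r / √3⌋).card : ℝ) * (r + 1) := by
        rw [← nsmul_eq_mul]
        refine Finset.sum_le_card_nsmul _ _ _ fun b _ => ?_
        refine (card_Icc_ceil_floor_le (by linarith)).trans (le_of_eq ?_)
        ring
    _ ≤ (2 * r / √3 + 1) * (r + 1) := by
        refine mul_le_mul_of_nonneg_right ?_ (by linarith)
        refine (card_Icc_ceil_floor_le (by gcongr; linarith)).trans (le_of_eq ?_)
        ring

theorem volume_biUnion_euBall_toReal (s : Finset (Σ _ : ℤ, ℤ)) :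
    (volume (⋃ p ∈ s, euBall (hexPoint p) (1 / 2))).toReal = s.card * (Real.pi / 4) := by
  rw [measure_biUnion_finset (fun p _ q _ hpq => pairwise_disjoint_euBall_hexPoint hpq)
    fun p _ => measurableSet_euBall _ _, ENNReal.toReal_sum fun p _ => ?_]
  · simp only [volume_euBall_half_toReal, Finset.sum_const, nsmul_eq_mul]
  · rw [volume_euBall]
    exact ENNReal.mul_ne_top (by simp) ENNReal.coe_ne_top

theorem volume_biUnion_euBall_ne_top (s : Finset (Σ _ : ℤ, ℤ)) :
    volume (⋃ p ∈ s, euBall (hexPoint p) (1 / 2)) ≠ ⊤ := by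
  refine ((measure_biUnion_finset_le _ _).trans_lt (ENNReal.sum_lt_top.2 fun p _ => ?_)).ne
  rw [volume_euBall]
  exact ENNReal.mul_lt_top (by simp) ENNReal.coe_lt_top

theorem mem_Icc_neg_self_iff {R : ℝ} {x : ℝ × ℝ} :
    x ∈ Set.Icc (-R, -R) (R, R) ↔ |x.1| ≤ R ∧ |x.2| ≤ R := by
  simp only [Set.mem_Icc, Prod.le_def, abs_le]
  tauto

theorem biUnion_euBall_subset_hexPacking_inter (R : ℝ) :
    ⋃ p ∈ hexIndices (R - 1 / 2), euBall (hexPoint p) (1 / 2) ⊆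
      hexPacking ∩ Set.Icc (-R, -R) (R, R) := by
  refine Set.iUnion₂_subset fun p hp x hx => ⟨?_, ?_⟩
  · rw [hexPacking_eq_iUnion]
    exact Set.mem_iUnion_of_mem p hx
  · simp only [euBall, Set.mem_ofPred_eq] at hx
    rw [mem_hexIndices] at hp
    rw [mem_Icc_neg_self_iff]
    constructor
    · linarith [abs_fst_sub_le_euDist x (hexPoint p), abs_sub_abs_le_abs_sub x.1 (hexPoint p).1]
    · linarith [abs_snd_sub_le_euDist x (hexPoint p), abs_sub_abs_le_abs_sub x.2 (hexPoint p).2]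

theorem hexPacking_inter_subset_biUnion_euBall (R : ℝ) :
    hexPacking ∩ Set.Icc (-R, -R) (R, R) ⊆
      ⋃ p ∈ hexIndices (R + 1 / 2), euBall (hexPoint p) (1 / 2) := by
  rintro x ⟨hx, hR⟩
  rw [hexPacking_eq_iUnion] at hx
  obtain ⟨p, hp⟩ := Set.mem_iUnion.1 hx
  refine Set.mem_biUnion (x := p) ?_ hp
  simp only [euBall, Set.mem_ofPred_eq] at hp
  rw [euDist_comm] at hp
  rw [mem_Icc_neg_self_iff] at hR
  rw [Finset.mem_coe, mem_hexIndices]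
  constructor
  · linarith [abs_fst_sub_le_euDist (hexPoint p) x, abs_sub_abs_le_abs_sub (hexPoint p).1 x.1]
  · linarith [abs_snd_sub_le_euDist (hexPoint p) x, abs_sub_abs_le_abs_sub (hexPoint p).2 x.2]

theorem tendsto_linear_mul_linear_div_sq (c d e f : ℝ) :
    Tendsto (fun R : ℝ => (c * R + d) * (e * R + f) / (2 * R) ^ 2) atTop
      (nhds (c * e / 4)) := by
  have hlim : Tendsto (fun R : ℝ => (c + d * R⁻¹) * (e + f * R⁻¹) / 4) atTop
      (nhds ((c + d * 0) * (e + f * 0) / 4)) :=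
    (((tendsto_inv_atTop_zero.const_mul d).const_add c).mul
      ((tendsto_inv_atTop_zero.const_mul f).const_add e)).div_const 4
  simp only [mul_zero, add_zero] at hlim
  refine hlim.congr' ?_
  filter_upwards [eventually_ne_atTop 0] with R hR
  field_simp
  ring

/-- The hexagonal disk packing avoids Euclidean distance 1, and its density exists and equals
`π/(8√3)`. -/
theorem hexPacking_avoiding_and_density :
    (∀ x ∈ hexPacking, ∀ y ∈ hexPacking, euDist x y ≠ 1) ∧
    Tendsto (fun R : ℝ =>
        (volume (hexPacking ∩ Set.Icc (-R, -R) (R, R))).toReal / (2 * R) ^ 2)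
      atTop (nhds (Real.pi / (8 * Real.sqrt 3))) := by
  refine ⟨fun x hx y hy => euDist_ne_one_of_mem_hexPacking hx hy, ?_⟩
  have hlim : Real.pi / (8 * √3) = 2 / √3 * (Real.pi / 4) / 4 := by ring
  rw [hlim]
  refine tendsto_of_tendsto_of_tendsto_of_le_of_le'
    (tendsto_linear_mul_linear_div_sq (2 / √3) (-1 / √3 - 1) (Real.pi / 4) (-3 / 2 * (Real.pi / 4)))
    (tendsto_linear_mul_linear_div_sq (2 / √3) (1 / √3 + 1) (Real.pi / 4) (3 / 2 * (Real.pi / 4)))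
    ?_ ?_
  · filter_upwards [eventually_ge_atTop 2] with R hR
    refine div_le_div_of_nonneg_right ?_ (sq_nonneg _)
    calc _ = (2 * (R - 1 / 2) / √3 - 1) * (R - 1 / 2 - 1) * (Real.pi / 4) := by ring
      _ ≤ (hexIndices (R - 1 / 2)).card * (Real.pi / 4) :=
        mul_le_mul_of_nonneg_right (le_card_hexIndices (by linarith)) (by positivity)
      _ ≤ _ := by
        rw [← volume_biUnion_euBall_toReal]
        exact ENNReal.toReal_mono
          (measure_ne_top_of_subset (hexPacking_inter_subset_biUnion_euBall R)
            (volume_biUnion_euBall_ne_top _))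
          (measure_mono (biUnion_euBall_subset_hexPacking_inter R))
  · filter_upwards [eventually_ge_atTop 0] with R hR
    refine div_le_div_of_nonneg_right ?_ (sq_nonneg _)
    calc _ ≤ (hexIndices (R + 1 / 2)).card * (Real.pi / 4) := by
          rw [← volume_biUnion_euBall_toReal]
          exact ENNReal.toReal_mono (volume_biUnion_euBall_ne_top _)
            (measure_mono (hexPacking_inter_subset_biUnion_euBall R))
      _ ≤ (2 * (R + 1 / 2) / √3 + 1) * (R + 1 / 2 + 1) * (Real.pi / 4) :=
        mul_le_mul_of_nonneg_right (card_hexIndices_le (by linarith)) (by positivity)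
      _ = _ := by ring
end
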